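/- arXiv:math/0204206 — 3 statements merged into one kernel-verified Lean document; each statement's English description precedes it below -/
import Mathlib

section
/- For every real number x > 0 there exists a polynomial p with real coefficients such that for all real y: ‖Γ(x + iy)‖ ≤ Γ(x)·|p(y)|·(cosh(πy))^{−1/2}, where Γ(x + iy) denotes the complex Gamma function, Γ(x) the real Gamma function, and ‖·‖ the complex absolute value. -/
/-- Along a vertical line, the ratio `‖Γ(a + iy)‖ / Γ(a)` is nondecreasing in `a > 0`. -/
theorem norm_Gamma_mul_Gamma_le {a b : ℝ} (ha : 0 < a) (hab : a ≤ b) (y : ℝ) :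
    ‖Complex.Gamma ((a : ℂ) + Complex.I * (y : ℂ))‖ * Real.Gamma b ≤
      ‖Complex.Gamma ((b : ℂ) + Complex.I * (y : ℂ))‖ * Real.Gamma a := by
  have hb : 0 < b := ha.trans_le hab
  have hnorm : ∀ c : ℝ, 0 < c → ‖Complex.Gamma (c : ℂ)‖ = Real.Gamma c := fun c hc => by
    rw [Complex.Gamma_ofReal, Complex.norm_real, Real.norm_of_nonneg (Real.Gamma_pos_of_pos hc).le]
  rw [← hnorm a ha, ← hnorm b hb]
  refine le_of_tendsto_of_tendsto
    ((Complex.GammaSeq_tendsto_Gamma _).norm.mul (Complex.GammaSeq_tendsto_Gamma _).norm)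
    ((Complex.GammaSeq_tendsto_Gamma _).norm.mul (Complex.GammaSeq_tendsto_Gamma _).norm) ?_
  filter_upwards [Filter.eventually_gt_atTop 0] with n hn
  have hseq : ∀ s : ℂ, ‖Complex.GammaSeq s n‖ = (n : ℝ) ^ s.re * (n.factorial : ℝ) /
      ∏ j ∈ Finset.range (n + 1), ‖s + j‖ := fun s => by
    rw [Complex.GammaSeq, norm_div, norm_mul, norm_prod, Complex.norm_natCast_cpow_of_pos hn,
      Complex.norm_natCast]
  have hprod : (∏ j ∈ Finset.range (n + 1), ‖(b : ℂ) + Complex.I * y + j‖) *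
        ∏ j ∈ Finset.range (n + 1), ‖(a : ℂ) + j‖ ≤
      (∏ j ∈ Finset.range (n + 1), ‖(a : ℂ) + Complex.I * y + j‖) *
        ∏ j ∈ Finset.range (n + 1), ‖(b : ℂ) + j‖ := by
    rw [← Finset.prod_mul_distrib, ← Finset.prod_mul_distrib]
    refine Finset.prod_le_prod (fun j _ => by positivity) fun j _ => ?_
    have hj : (0 : ℝ) ≤ j := j.cast_nonneg
    refine (sq_le_sq₀ (by positivity) (by positivity)).mp ?_
    simp only [mul_pow, ← Complex.normSq_eq_norm_sq, Complex.normSq_apply]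
    simp
    have h : (a + j) * (a + j) ≤ (b + j) * (b + j) := by gcongr
    nlinarith [mul_le_mul_of_nonneg_right h (mul_self_nonneg y)]
  have hpos : ∀ s : ℂ, 0 < s.re → 0 < ∏ j ∈ Finset.range (n + 1), ‖s + j‖ := fun s hs => by
    refine Finset.prod_pos fun j _ => norm_pos_iff.mpr fun h => ?_
    have h_re := congrArg Complex.re h
    simp only [Complex.add_re, Complex.natCast_re, Complex.zero_re] at h_re
    linarith [(j.cast_nonneg : (0 : ℝ) ≤ j)]
  have ha' := hpos a (by simpa)
  have hb' := hpos b (by simpa)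
  have hay := hpos (a + Complex.I * y) (by simpa)
  have hby := hpos (b + Complex.I * y) (by simpa)
  have hre : ∀ c : ℝ, ((c : ℂ) + Complex.I * y).re = c := fun c => by simp
  rw [hseq, hseq, hseq, hseq, hre, hre, Complex.ofReal_re, Complex.ofReal_re, div_mul_div_comm,
    div_mul_div_comm, mul_comm ((n : ℝ) ^ b * _)]
  gcongr

/-- The modulus of `Γ` on the vertical line through the half-integer `m + 1/2`. -/
theorem norm_Gamma_half_integer (m : ℕ) (y : ℝ) :
    ‖Complex.Gamma (((m + 1 / 2 : ℝ) : ℂ) + Complex.I * (y : ℂ))‖ =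
      (∏ k ∈ Finset.range m, ‖((k + 1 / 2 : ℝ) : ℂ) + Complex.I * y‖) *
        (√Real.pi * Real.cosh (Real.pi * y) ^ (-(1 / 2) : ℝ)) := by
  induction m with
  | zero =>
    have hc : 0 < Real.cosh (Real.pi * y) := Real.cosh_pos _
    set z : ℂ := ((1 / 2 : ℝ) : ℂ) + Complex.I * y with hz
    have hconj : (1 : ℂ) - z = (starRingEnd ℂ) z := by
      apply Complex.ext <;> norm_num [hz]
    have hsin : Complex.sin (Real.pi * z) = (Real.cosh (Real.pi * y) : ℝ) := by
      have : (Real.pi : ℂ) * z = (Real.pi * y : ℂ) * Complex.I + Real.pi / 2 := by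
        rw [hz]; push_cast; ring
      rw [this, Complex.sin_add_pi_div_two, Complex.cos_mul_I]
      push_cast; rfl
    have hsq : ‖Complex.Gamma z‖ ^ 2 = Real.pi / Real.cosh (Real.pi * y) := by
      have h := congrArg norm (Complex.Gamma_mul_Gamma_one_sub z)
      rw [hconj, Complex.Gamma_conj, hsin, norm_mul, RCLike.norm_conj, norm_div, Complex.norm_real,
        Complex.norm_real, Real.norm_of_nonneg Real.pi_pos.le, Real.norm_of_nonneg hc.le] at h
      rw [sq, h]
    have hmod : ‖Complex.Gamma z‖ = √Real.pi * Real.cosh (Real.pi * y) ^ (-(1 / 2) : ℝ) := by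
      rw [Real.rpow_neg hc.le, ← Real.sqrt_eq_rpow, ← div_eq_mul_inv, ← Real.sqrt_div Real.pi_pos.le,
        ← hsq, Real.sqrt_sq (norm_nonneg _)]
    simpa [hz] using hmod
  | succ m ih =>
    set z : ℂ := ((m + 1 / 2 : ℝ) : ℂ) + Complex.I * y with hz
    have hz0 : z ≠ 0 := fun h => by
      have := congrArg Complex.re h
      simp [hz] at this
      linarith [(m.cast_nonneg : (0 : ℝ) ≤ m)]
    have hadd : (((m + 1 : ℕ) + 1 / 2 : ℝ) : ℂ) + Complex.I * y = z + 1 := by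
      rw [hz]; push_cast; ring
    rw [hadd, Complex.Gamma_add_one z hz0, norm_mul, ih, Finset.prod_range_succ]
    ring

/-- for every `x > 0` there is a real polynomial `p` with
`‖Γ(x + iy)‖ ≤ Γ(x)·|p(y)|·(cosh(πy))^{−1/2}` for all real `y`. -/
theorem gamma_vertical_line_bound (x : ℝ) (hx : 0 < x) :
    ∃ p : Polynomial ℝ, ∀ y : ℝ,
      ‖Complex.Gamma ((x : ℂ) + Complex.I * (y : ℂ))‖ ≤
        Real.Gamma x * |p.eval y| * Real.cosh (Real.pi * y) ^ (-(1 / 2) : ℝ) := by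
  obtain ⟨m, hm⟩ := exists_nat_ge x
  have hG : 0 < Real.Gamma (m + 1 / 2 : ℝ) := Real.Gamma_pos_of_pos (by positivity)
  refine ⟨Polynomial.C (√Real.pi / Real.Gamma (m + 1 / 2 : ℝ)) *
    ∏ k ∈ Finset.range m, (Polynomial.C ((k + 1 / 2 : ℝ) ^ 2 + 1) + Polynomial.X ^ 2), fun y => ?_⟩
  have hprod : ∏ k ∈ Finset.range m, ‖((k + 1 / 2 : ℝ) : ℂ) + Complex.I * y‖ ≤
      ∏ k ∈ Finset.range m, ((k + 1 / 2 : ℝ) ^ 2 + 1 + y ^ 2) := by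
    refine Finset.prod_le_prod (fun _ _ => norm_nonneg _) fun k _ => ?_
    have h : ‖((k + 1 / 2 : ℝ) : ℂ) + Complex.I * y‖ ^ 2 = (k + 1 / 2 : ℝ) ^ 2 + y ^ 2 := by
      rw [← Complex.normSq_eq_norm_sq, mul_comm Complex.I, Complex.normSq_add_mul_I]
    nlinarith [sq_nonneg (‖((k + 1 / 2 : ℝ) : ℂ) + Complex.I * y‖ - 1)]
  have hmono := norm_Gamma_mul_Gamma_le hx (by linarith : x ≤ m + 1 / 2) y
  rw [norm_Gamma_half_integer, ← le_div_iff₀ hG] at hmono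
  refine hmono.trans ?_
  have hΓ := (Real.Gamma_pos_of_pos hx).le
  have hc := (Real.cosh_pos (Real.pi * y)).le
  simp only [Polynomial.eval_mul, Polynomial.eval_C, Polynomial.eval_prod, Polynomial.eval_add,
    Polynomial.eval_pow, Polynomial.eval_X]
  rw [abs_of_nonneg (by positivity)]
  calc _ ≤ (∏ k ∈ Finset.range m, ((k + 1 / 2 : ℝ) ^ 2 + 1 + y ^ 2)) *
        (√Real.pi * Real.cosh (Real.pi * y) ^ (-(1 / 2) : ℝ)) * Real.Gamma x /
          Real.Gamma (m + 1 / 2 : ℝ) := by gcongr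
    _ = _ := by ring
end

section
/- In the universal enveloping algebra U of gl(N,ℂ), for every 1 ≤ n ≤ N−1 and every λ ∈ ℂ, the quantum minor ℬ_n(λ) equals the commutator [𝒜_n(λ), E_{n,n+1}] = 𝒜_n(λ)·E_{n,n+1} − E_{n,n+1}·𝒜_n(λ). -/
open Finset

noncomputable section

attribute [local instance 100] LieRing.ofAssociativeRing

/-- The universal enveloping algebra of `gl(N, ℂ)`. -/
abbrev UEA (N : ℕ) := UniversalEnvelopingAlgebra ℂ (Matrix (Fin N) (Fin N) ℂ)

/-- The image `E_{ab}` in the universal enveloping algebra of the matrix unit `e_{ab}`. -/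
def Egen (N : ℕ) (a b : Fin N) : UEA N :=
  UniversalEnvelopingAlgebra.ι ℂ (Matrix.single a b 1)

/-- The quantum minor `qdet_{r,c}(λ) = Σ_{p ∈ S_n} sgn(p) ∏_{k=1}^{n}
((λ − iℏρ_k^{(n)})·δ_{r_{p(k)},c_k}·1 − iℏ·E_{r_{p(k)},c_k})`, the noncommutative
product taken in increasing order of `k`, with `ρ_k^{(n)} = (n − 2k + 1)/2`. -/
def qdet (ℏ : ℂ) (N n : ℕ) (r c : Fin n → Fin N) (lam : ℂ) : UEA N :=
  ∑ p : Equiv.Perm (Fin n),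
    ((Equiv.Perm.sign p : ℤ) : ℂ) •
      ((List.finRange n).map (fun (k : Fin n) =>
        (algebraMap ℂ (UEA N))
            ((lam - Complex.I * ℏ * (((n : ℂ) - 2 * (((k : ℕ) : ℂ) + 1) + 1) / 2)) *
              (if r (p k) = c k then 1 else 0)) -
          (Complex.I * ℏ) • Egen N (r (p k)) (c k))).prod

theorem Egen_lie (N : ℕ) (a b c d : Fin N) :
    Egen N a b * Egen N c d - Egen N c d * Egen N a b =
      (if b = c then Egen N a d else 0) - (if d = a then Egen N c b else 0) := by
  have key : ⁅(Matrix.single a b 1 : Matrix (Fin N) (Fin N) ℂ),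
      (Matrix.single c d 1 : Matrix (Fin N) (Fin N) ℂ)⁆ =
      (if b = c then Matrix.single a d 1 else 0) - (if d = a then Matrix.single c b 1 else 0) := by
    rw [LieRing.of_associative_ring_bracket]
    congr 1
    · split_ifs with h
      · subst h; simp
      · exact Matrix.single_mul_single_of_ne _ _ _ _ h _
    · split_ifs with h
      · subst h; simp
      · exact Matrix.single_mul_single_of_ne _ _ _ _ h _
  have h := congrArg (UniversalEnvelopingAlgebra.ι ℂ) key
  rw [LieHom.map_lie, LieRing.of_associative_ring_bracket, map_sub] at h
  simpa only [Egen, apply_ite (UniversalEnvelopingAlgebra.ι ℂ), map_zero] using h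

theorem affine_Egen_commutator (N : ℕ) (s t : ℂ) (a b c d : Fin N) (hd : d ≠ a) :
    (algebraMap ℂ (UEA N) s - t • Egen N a b) * Egen N c d -
        Egen N c d * (algebraMap ℂ (UEA N) s - t • Egen N a b) =
      if b = c then -(t • Egen N a d) else 0 := by
  have h := Egen_lie N a b c d
  rw [if_neg hd, sub_zero] at h
  calc _ = -(t • (Egen N a b * Egen N c d - Egen N c d * Egen N a b)) := by
        rw [sub_mul, mul_sub, Algebra.commutes s (Egen N c d), smul_mul_assoc, mul_smul_comm,
          smul_sub]
        abel
    _ = _ := by rw [h]; split_ifs <;> simp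

theorem Commute.mul_mul_sub_mul_mul {R : Type*} [Ring R] {e x : R} (h : Commute e x) (y : R) :
    x * y * e - e * (x * y) = x * (y * e - e * y) := by
  rw [← mul_assoc e, h.eq, mul_sub, mul_assoc, mul_assoc]

/-- the quantum minor `ℬ_n(λ)` (rows `1,…,n`, columns `1,…,n−1,n+1`)
equals the commutator `[𝒜_n(λ), E_{n,n+1}]`, where `𝒜_n(λ)` is the principal
quantum minor (rows and columns `1,…,n`). -/
theorem qminor_B_eq_commutator (ℏ : ℂ) (N : ℕ) (hN : 2 ≤ N)
    (n : ℕ) (hn1 : 1 ≤ n) (hn : n ≤ N - 1) (lam : ℂ) :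
    qdet ℏ N n (fun k => Fin.castLE (by omega) k)
        (fun k => if (k : ℕ) + 1 = n then (⟨n, by omega⟩ : Fin N) else Fin.castLE (by omega) k)
        lam =
      qdet ℏ N n (fun k => Fin.castLE (by omega) k) (fun k => Fin.castLE (by omega) k) lam *
          Egen N ⟨n - 1, by omega⟩ ⟨n, by omega⟩ -
        Egen N ⟨n - 1, by omega⟩ ⟨n, by omega⟩ *
          qdet ℏ N n (fun k => Fin.castLE (by omega) k) (fun k => Fin.castLE (by omega) k) lam := by
  obtain ⟨m, rfl⟩ : ∃ m, n = m + 1 := ⟨n - 1, by omega⟩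
  simp only [qdet]
  rw [Finset.sum_mul, Finset.mul_sum, ← Finset.sum_sub_distrib]
  refine Finset.sum_congr rfl fun p _ => ?_
  rw [smul_mul_assoc, mul_smul_comm, ← smul_sub]
  congr 1
  simp only [List.finRange_succ_last, List.map_append, List.map_map, List.prod_append,
    List.map_cons, List.map_nil, List.prod_singleton]
  have hne : ∀ k : Fin (m + 1), (⟨m + 1, by omega⟩ : Fin N) ≠ Fin.castLE (by omega) k := by
    intro k h
    have := congrArg Fin.val h
    simp only [Fin.val_castLE] at this
    omega
  rw [Commute.mul_mul_sub_mul_mul (Commute.list_prod_right _ _ ?_),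
    affine_Egen_commutator _ _ _ _ _ _ _ (hne _)]
  · congr 1
    · congr 1
      refine List.map_congr_left fun k _ => ?_
      have hk : (k : ℕ) ≠ m := by omega
      simp [hk, Fin.ext_iff]
    · have hlast : (Fin.castLE (by omega) (Fin.last m) : Fin N) = ⟨m, by omega⟩ :=
        Fin.ext (by simp)
      simp [hlast, (hne (p (Fin.last m))).symm]
  · intro x hx
    obtain ⟨k, -, rfl⟩ := List.mem_map.mp hx
    refine (sub_eq_zero.mp ((affine_Egen_commutator _ _ _ _ _ _ _ (hne _)).trans
      (if_neg fun h => ?_))).symm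
    have := congrArg Fin.val h
    simp only [Fin.val_castLE, Fin.val_castSucc] at this
    omega
end
end

section
/- Fix ℏ > 0, N ≥ 2, and real numbers γ_{N1},…,γ_{NN}. Then the function ℝ^{N(N−1)/2} → ℝ sending (γ_{nj})_{1≤j≤n≤N−1} to ∏_{n=1}^{N−1} [∏_{k=1}^{n}∏_{m=1}^{n+1} ‖Γ((γ_{nk} − γ_{n+1,m})/(2iℏ) + 1/4)‖² / ∏_{1≤s<p≤n} ‖Γ((γ_{ns} − γ_{np})/(iℏ))‖²] is Lebesgue integrable on ℝ^{N(N−1)/2}; consequently the integral representation of the hyperbolic Sutherland eigenfunction, whose integrand is this product times a factor of modulus one, converges absolutely. -/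
open Finset MeasureTheory

noncomputable section

/-- A Gelfand–Zetlin array: complex values `γ n j`, relevant for `1 ≤ j ≤ n ≤ N`. -/
abbrev GZ := ℕ → ℕ → ℂ

/-- Index set of the Gelfand–Zetlin variables `(n, j)` with `1 ≤ j ≤ n ≤ N − 1`
(the pair `(p.1, p.2)` encodes `(n, j)`). -/
abbrev GZIdx (N : ℕ) := {p : Fin N × Fin N // 1 ≤ (p.2 : ℕ) ∧ (p.2 : ℕ) ≤ (p.1 : ℕ)}

/-- The Gelfand–Zetlin array with lower levels given by the real variables `ξ`
and top row `g`. -/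
def gzOf (N : ℕ) (g : ℕ → ℂ) (ξ : GZIdx N → ℝ) : GZ := fun n j =>
  if h : 1 ≤ j ∧ j ≤ n ∧ n < N then
    ((ξ ⟨(⟨n, h.2.2⟩, ⟨j, lt_of_le_of_lt h.2.1 h.2.2⟩), h.1, h.2.1⟩ : ℝ) : ℂ)
  else g j

/-- Cross distances of two finite families of reals, minus the distances inside each family. -/
def crossEnergy {ι κ : Type*} (s : Finset ι) (t : Finset κ) (x : ι → ℝ) (y : κ → ℝ) : ℝ :=
  ∑ k ∈ s, ∑ m ∈ t, |x k - y m| - (∑ k ∈ s, ∑ l ∈ s, |x k - x l|) / 2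
    - (∑ k ∈ t, ∑ l ∈ t, |y k - y l|) / 2

/-- The indicator that `u` lies weakly below `a`. -/
def belowInd (u a : ℝ) : ℝ := if u ≤ a then 1 else 0

lemma indicator_uIoc_eq_belowInd (a b u : ℝ) :
    (Set.uIoc a b).indicator (fun _ => (1 : ℝ)) u =
      belowInd u a + belowInd u b - 2 * (belowInd u a * belowInd u b) := by
  simp only [belowInd, Set.indicator, Set.mem_uIoc]
  split_ifs <;> grind

lemma integrable_indicator_uIoc (a b : ℝ) :
    Integrable ((Set.uIoc a b).indicator (fun _ => (1 : ℝ))) := by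
  rw [integrable_indicator_iff measurableSet_uIoc]
  exact integrableOn_const (by simp [Real.volume_uIoc])

lemma integral_indicator_uIoc (a b : ℝ) :
    ∫ u, (Set.uIoc a b).indicator (fun _ => (1 : ℝ)) u = |a - b| := by
  rw [integral_indicator measurableSet_uIoc]
  simp [Measure.real, Real.volume_uIoc, abs_sub_comm]

lemma integral_sum_sum_indicator_uIoc {ι κ : Type*} (s : Finset ι) (t : Finset κ) (x : ι → ℝ)
    (y : κ → ℝ) :
    ∫ u, ∑ k ∈ s, ∑ m ∈ t, (Set.uIoc (x k) (y m)).indicator (fun _ => (1 : ℝ)) u =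
      ∑ k ∈ s, ∑ m ∈ t, |x k - y m| := by
  have hI := integrable_indicator_uIoc
  rw [integral_finsetSum _ fun _ _ => integrable_finsetSum _ fun _ _ => hI _ _]
  refine sum_congr rfl fun k _ => ?_
  rw [integral_finsetSum _ fun _ _ => hI _ _]
  exact sum_congr rfl fun m _ => integral_indicator_uIoc _ _

lemma sum_sum_add_sub_two_mul {ι κ : Type*} (s : Finset ι) (t : Finset κ) (a : ι → ℝ)
    (b : κ → ℝ) :
    ∑ k ∈ s, ∑ m ∈ t, (a k + b m - 2 * (a k * b m)) =
      #t * ∑ k ∈ s, a k + #s * ∑ m ∈ t, b m - 2 * ((∑ k ∈ s, a k) * ∑ m ∈ t, b m) := by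
  simp only [sum_sub_distrib, sum_add_distrib, sum_const, nsmul_eq_mul, ← mul_sum, ← sum_mul]

lemma sum_belowInd {ι : Type*} (s : Finset ι) (x : ι → ℝ) (u : ℝ) :
    ∑ k ∈ s, belowInd u (x k) = ((#{k ∈ s | u ≤ x k} : ℕ) : ℝ) := by
  simp [belowInd]

lemma integral_crossEnergy {ι κ : Type*} (s : Finset ι) (t : Finset κ) (h : #t = #s + 1)
    (x : ι → ℝ) (y : κ → ℝ) :
    let φ : ℝ → ℝ := fun u =>
      ((∑ k ∈ s, belowInd u (x k)) - ∑ m ∈ t, belowInd u (y m)) *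
        ((∑ k ∈ s, belowInd u (x k)) - (∑ m ∈ t, belowInd u (y m)) + 1)
    Integrable φ ∧ ∫ u, φ u = crossEnergy s t x y := by
  intro φ
  let I : ℝ → ℝ → ℝ → ℝ := fun a b => (Set.uIoc a b).indicator (fun _ => (1 : ℝ))
  have hI : ∀ a b, Integrable (I a b) := integrable_indicator_uIoc
  have hφ : φ = fun u => ∑ k ∈ s, ∑ m ∈ t, I (x k) (y m) u
      - (∑ k ∈ s, ∑ l ∈ s, I (x k) (x l) u) / 2 - (∑ k ∈ t, ∑ l ∈ t, I (y k) (y l) u) / 2 := by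
    funext u
    simp only [φ, I, indicator_uIoc_eq_belowInd]
    rw [sum_sum_add_sub_two_mul s t (fun k => belowInd u (x k)) (fun m => belowInd u (y m)),
      sum_sum_add_sub_two_mul s s (fun k => belowInd u (x k)) (fun k => belowInd u (x k)),
      sum_sum_add_sub_two_mul t t (fun k => belowInd u (y k)) (fun k => belowInd u (y k)), h]
    push_cast
    ring
  have h1 : Integrable fun u => ∑ k ∈ s, ∑ m ∈ t, I (x k) (y m) u :=
    integrable_finsetSum _ fun _ _ => integrable_finsetSum _ fun _ _ => hI _ _
  have h2 : Integrable fun u => (∑ k ∈ s, ∑ l ∈ s, I (x k) (x l) u) / 2 :=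
    (integrable_finsetSum _ fun _ _ => integrable_finsetSum _ fun _ _ => hI _ _).div_const _
  have h3 : Integrable fun u => (∑ k ∈ t, ∑ l ∈ t, I (y k) (y l) u) / 2 :=
    (integrable_finsetSum _ fun _ _ => integrable_finsetSum _ fun _ _ => hI _ _).div_const _
  refine ⟨hφ ▸ (h1.sub h2).sub h3, ?_⟩
  rw [hφ]
  refine (integral_sub (h1.sub h2) h3).trans ?_
  simp only [Pi.sub_apply]
  simp only [I]
  rw [integral_sub h1 h2, integral_div, integral_div, integral_sum_sum_indicator_uIoc,
    integral_sum_sum_indicator_uIoc, integral_sum_sum_indicator_uIoc, crossEnergy]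

lemma int_mul_add_one_nonneg (d : ℤ) : 0 ≤ d * (d + 1) := by
  rcases le_or_gt 0 d with h | h
  · positivity
  · nlinarith

lemma crossEnergy_nonneg {ι κ : Type*} (s : Finset ι) (t : Finset κ) (h : #t = #s + 1)
    (x : ι → ℝ) (y : κ → ℝ) : 0 ≤ crossEnergy s t x y := by
  obtain ⟨-, hφ⟩ := integral_crossEnergy s t h x y
  rw [← hφ]
  refine integral_nonneg fun u => ?_
  simp only [sum_belowInd, Pi.zero_apply]
  exact_mod_cast int_mul_add_one_nonneg (#{k ∈ s | u ≤ x k} - #{m ∈ t | u ≤ y m} : ℤ)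

/-- The cross energy dominates twice the length of an interval on which the counting functions
of the two families differ by neither `0` nor `-1`. -/
lemma two_mul_le_crossEnergy {ι κ : Type*} (s : Finset ι) (t : Finset κ) (h : #t = #s + 1)
    (x : ι → ℝ) (y : κ → ℝ) (a b : ℝ)
    (hab : ∀ u ∈ Set.uIoc a b, 2 ≤ ((#{k ∈ s | u ≤ x k} - #{m ∈ t | u ≤ y m} : ℤ)) *
      ((#{k ∈ s | u ≤ x k} - #{m ∈ t | u ≤ y m} : ℤ) + 1)) :
    2 * |a - b| ≤ crossEnergy s t x y := by
  obtain ⟨hi, hφ⟩ := integral_crossEnergy s t h x y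
  rw [← hφ, ← integral_indicator_uIoc, ← integral_const_mul]
  refine integral_mono ((integrable_indicator_uIoc a b).const_mul 2) hi fun u => ?_
  simp only [sum_belowInd]
  by_cases hu : u ∈ Set.uIoc a b
  · simp only [Set.indicator_of_mem hu, mul_one]
    exact_mod_cast hab u hu
  · simp only [Set.indicator_of_notMem hu, mul_zero]
    exact_mod_cast int_mul_add_one_nonneg (#{k ∈ s | u ≤ x k} - #{m ∈ t | u ≤ y m} : ℤ)

lemma abs_le_add_crossEnergy {ι κ : Type*} (s : Finset ι) (t : Finset κ) (h : #t = #s + 1)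
    (x : ι → ℝ) (y : κ → ℝ) {M : ℝ} (hM : ∀ m ∈ t, |y m| ≤ M) {k : ι} (hk : k ∈ s) :
    |x k| ≤ M + crossEnergy s t x y / 2 := by
  have h0 := crossEnergy_nonneg s t h x y
  obtain ⟨m, hm⟩ := card_pos.1 (h ▸ Nat.succ_pos _ : 0 < #t)
  have hM0 : 0 ≤ M := (abs_nonneg _).trans (hM m hm)
  rcases le_or_gt |x k| M with hx | hx
  · linarith
  rcases lt_abs.1 hx with hx | hx
  · have key := two_mul_le_crossEnergy s t h x y (x k) M fun u hu => by
      rw [Set.uIoc_of_ge hx.le] at hu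
      have h1 : 0 < #{k ∈ s | u ≤ x k} := card_pos.2 ⟨k, mem_filter.2 ⟨hk, hu.2⟩⟩
      have h2 : #{m ∈ t | u ≤ y m} = 0 := card_eq_zero.2 <| filter_eq_empty_iff.2 fun m hm =>
        not_le.2 (((abs_le.1 (hM m hm)).2).trans_lt hu.1)
      rw [h2]
      have h3 : (1 : ℤ) ≤ #{k ∈ s | u ≤ x k} := by exact_mod_cast h1
      push_cast
      nlinarith
    rw [abs_of_pos (sub_pos.2 hx)] at key
    rw [abs_of_pos (by linarith)]
    linarith
  · have key := two_mul_le_crossEnergy s t h x y (x k) (-M) fun u hu => by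
      rw [Set.uIoc_of_le (by linarith)] at hu
      have h1 : #{k ∈ s | u ≤ x k} < #s := card_lt_card <| filter_ssubset.2
        ⟨k, hk, not_le.2 hu.1⟩
      have h2 : #{m ∈ t | u ≤ y m} = #t := by
        rw [filter_true_of_mem fun m hm => hu.2.trans (abs_le.1 (hM m hm)).1]
      rw [h2, h]
      have h3 : (#{k ∈ s | u ≤ x k} : ℤ) + 1 ≤ #s := by exact_mod_cast h1
      push_cast
      nlinarith
    rw [abs_of_neg (by linarith)] at key
    rw [abs_of_neg (by linarith)]
    linarith

lemma sum_Icc_sum_Icc_eq_two_mul (n : ℕ) (x : ℕ → ℝ) :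
    ∑ s ∈ Icc 1 n, ∑ p ∈ Icc 1 n, |x s - x p| =
      2 * ∑ s ∈ Icc 1 n, ∑ p ∈ Ioc s n, |x s - x p| := by
  induction n with
  | zero => simp
  | succ n ih =>
    have hL : ∀ s ∈ Icc 1 n, ∑ p ∈ Ioc s (n + 1), |x s - x p| =
        ∑ p ∈ Ioc s n, |x s - x p| + |x s - x (n + 1)| := fun s hs =>
      sum_Ioc_succ_top (mem_Icc.1 hs).2 _
    rw [sum_Icc_succ_top (by omega), sum_Icc_succ_top (by omega), sum_Icc_succ_top (by omega),
      sum_congr rfl hL, sum_congr rfl fun s _ => sum_Icc_succ_top (Nat.le_add_left 1 n) _,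
      sum_add_distrib, sum_add_distrib, ih]
    simp only [abs_sub_comm (x (n + 1)), Ioc_self, sum_empty, sub_self, abs_zero]
    ring

/-- The exponential decay rate of the Gelfand–Zetlin integrand bounds every variable. -/
lemma abs_le_gzEnergy (r : ℕ → ℕ → ℝ) (K : ℕ) {M : ℝ}
    (hM : ∀ m ∈ Icc 1 (K + 1), |r (K + 1) m| ≤ M)
    {n k : ℕ} (hk : k ∈ Icc 1 n) (hn : n ≤ K) :
    2 * (|r n k| - M) ≤ ∑ i ∈ Icc 1 K, (∑ k ∈ Icc 1 i, ∑ m ∈ Icc 1 (i + 1), |r i k - r (i + 1) m| -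
      2 * ∑ s ∈ Icc 1 i, ∑ p ∈ Ioc s i, |r i s - r i p|) := by
  set V : ℕ → ℝ := fun i => ∑ s ∈ Icc 1 i, ∑ p ∈ Ioc s i, |r i s - r i p| with hV
  set D : ℕ → ℝ := fun i => crossEnergy (Icc 1 i) (Icc 1 (i + 1)) (r i) (r (i + 1)) with hD
  have hD0 : ∀ i, 0 ≤ D i := fun i => crossEnergy_nonneg _ _ (by simp) _ _
  have hterm : ∀ i, ∑ k ∈ Icc 1 i, ∑ m ∈ Icc 1 (i + 1), |r i k - r (i + 1) m| - 2 * V i =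
      D i + (V (i + 1) - V i) := fun i => by
    simp only [hD, crossEnergy, sum_Icc_sum_Icc_eq_two_mul, hV]
    ring
  have hbound : ∀ j, ∀ n, n + j = K + 1 → ∀ k ∈ Icc 1 n,
      |r n k| ≤ M + (∑ i ∈ Ico n (K + 1), D i) / 2 := by
    intro j
    induction j with
    | zero =>
      rintro n rfl k hk
      simpa using hM k hk
    | succ j ih =>
      intro n hn k hk
      have := abs_le_add_crossEnergy (Icc 1 n) (Icc 1 (n + 1)) (by simp) (r n) (r (n + 1))
        (ih (n + 1) (by omega)) hk
      rw [sum_eq_sum_Ico_succ_bot (by omega)]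
      change _ ≤ _ + D n / 2 at this
      linarith
  have h1 := hbound (K + 1 - n) n (by omega) k hk
  have h2 : ∑ i ∈ Ico n (K + 1), D i ≤ ∑ i ∈ Icc 1 K, D i :=
    sum_le_sum_of_subset_of_nonneg (fun i hi => by simp at hi hk ⊢; omega) fun i _ _ => hD0 i
  have h3 : ∑ i ∈ Icc 1 K, (V (i + 1) - V i) = V (K + 1) := by
    rw [← Ico_add_one_right_eq_Icc, sum_Ico_sub V (Nat.le_add_left 1 K)]
    simp [hV]
  have h4 : 0 ≤ V (K + 1) := sum_nonneg fun _ _ => sum_nonneg fun _ _ => abs_nonneg _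
  rw [sum_congr rfl fun i _ => hterm i, sum_add_distrib, h3]
  linarith

lemma norm_betaIntegral_le (s t : ℂ) :
    ‖Complex.betaIntegral s t‖ ≤ ∫ x : ℝ in 0..1, x ^ (s.re - 1) * (1 - x) ^ (t.re - 1) := by
  rw [Complex.betaIntegral]
  refine (intervalIntegral.norm_integral_le_integral_norm zero_le_one).trans_eq ?_
  refine intervalIntegral.integral_congr_Ioo_of_le zero_le_one fun x hx => ?_
  have h : (1 : ℂ) - x = ((1 - x : ℝ) : ℂ) := by push_cast; rfl
  rw [norm_mul, h, Complex.norm_cpow_eq_rpow_re_of_pos hx.1,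
    Complex.norm_cpow_eq_rpow_re_of_pos (sub_pos.2 hx.2)]
  simp

lemma exp_div_two_le_norm_sin (b : ℝ) :
    Real.exp |b| / 2 ≤ ‖Complex.sin (Real.pi / 4 + b * Complex.I)‖ := by
  have h1 : ‖Complex.sin (Real.pi / 4 + b * Complex.I)‖ ^ 2 = Real.cosh (2 * b) / 2 := by
    have : Complex.sin (Real.pi / 4 + b * Complex.I) =
        (Real.sin (Real.pi / 4) * Real.cosh b : ℝ) +
          (Real.cos (Real.pi / 4) * Real.sinh b : ℝ) * Complex.I := by
      rw [Complex.sin_add_mul_I]; push_cast; rfl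
    rw [this, Complex.sq_norm, Complex.normSq_add_mul_I, Real.cosh_two_mul, Real.sin_pi_div_four,
      Real.cos_pi_div_four, mul_pow, mul_pow, div_pow, Real.sq_sqrt zero_le_two]
    ring
  refine abs_le_of_sq_le_sq' ?_ (norm_nonneg _) |>.2
  rw [h1, ← Real.cosh_abs, Real.cosh_eq, abs_mul, abs_two, div_pow, ← Real.exp_nat_mul]
  push_cast
  linarith [Real.exp_pos (-(2 * |b|))]

/-- Exponential decay of the Gamma function on the line `re = 1 / 4`. -/
lemma exists_norm_Gamma_quarter_sq_le :
    ∃ C : ℝ, 0 < C ∧ ∀ b : ℝ, ‖Complex.Gamma (1 / 4 + b * Complex.I)‖ ^ 2 ≤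
      C * Real.exp (-(Real.pi * |b|)) := by
  set B : ℝ := ∫ x : ℝ in 0..1, x ^ ((1 / 4 : ℝ) - 1) * (1 - x) ^ ((1 / 2 : ℝ) - 1)
  have hB : 0 ≤ B := intervalIntegral.integral_nonneg zero_le_one fun x hx =>
    mul_nonneg (Real.rpow_nonneg hx.1 _) (Real.rpow_nonneg (sub_nonneg.2 hx.2) _)
  refine ⟨B * (2 * Real.pi) + 1, by positivity, fun b => ?_⟩
  set s : ℂ := 1 / 4 + b * Complex.I with hs
  have hsre : s.re = 1 / 4 := by simp [hs]
  have hhalf : ((1 / 2 : ℂ)).re = 1 / 2 := by norm_num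
  have hbeta := Complex.Gamma_mul_Gamma_eq_betaIntegral (s := s) (t := 1 / 2)
    (by rw [hsre]; norm_num) (by rw [hhalf]; norm_num)
  have hbn : ‖Complex.betaIntegral s (1 / 2)‖ ≤ B := by
    simpa only [hsre, hhalf] using norm_betaIntegral_le s (1 / 2)
  have hG : 1 ≤ ‖Complex.Gamma (1 / 2)‖ := by
    rw [Complex.Gamma_one_half_eq, Complex.norm_cpow_eq_rpow_re_of_pos Real.pi_pos]
    exact Real.one_le_rpow (by linarith [Real.pi_gt_three]) (by norm_num)
  have hcomp : ‖Complex.Gamma s‖ ≤ ‖Complex.Gamma (1 - s)‖ * B := by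
    have hconj : ‖Complex.Gamma (s + 1 / 2)‖ = ‖Complex.Gamma (1 - s)‖ := by
      rw [← Complex.norm_conj (Complex.Gamma (1 - s)), ← Complex.Gamma_conj]
      congr 2
      apply Complex.ext <;> simp [hs]
      norm_num
    calc ‖Complex.Gamma s‖ ≤ ‖Complex.Gamma s‖ * ‖Complex.Gamma (1 / 2)‖ :=
          le_mul_of_one_le_right (norm_nonneg _) hG
      _ = ‖Complex.Gamma (1 - s)‖ * ‖Complex.betaIntegral s (1 / 2)‖ := by
          rw [← norm_mul, hbeta, norm_mul, hconj]
      _ ≤ _ := by gcongr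
  have hrefl : ‖Complex.Gamma s‖ * ‖Complex.Gamma (1 - s)‖ ≤
      2 * Real.pi * Real.exp (-(Real.pi * |b|)) := by
    have hsin := exp_div_two_le_norm_sin (Real.pi * b)
    have harg : (Real.pi : ℂ) * s = Real.pi / 4 + (Real.pi * b : ℝ) * Complex.I := by
      rw [hs]; push_cast; ring
    rw [abs_mul, abs_of_pos Real.pi_pos] at hsin
    rw [← norm_mul, Complex.Gamma_mul_Gamma_one_sub, norm_div, harg, Complex.norm_real,
      Real.norm_of_nonneg Real.pi_pos.le, Real.exp_neg, ← div_eq_mul_inv]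
    calc _ ≤ Real.pi / (Real.exp (Real.pi * |b|) / 2) := by gcongr
      _ = _ := by field_simp
  calc ‖Complex.Gamma s‖ ^ 2 ≤ ‖Complex.Gamma s‖ * (‖Complex.Gamma (1 - s)‖ * B) := by
        rw [sq]; gcongr
    _ = B * (‖Complex.Gamma s‖ * ‖Complex.Gamma (1 - s)‖) := by ring
    _ ≤ B * (2 * Real.pi * Real.exp (-(Real.pi * |b|))) := by gcongr
    _ ≤ _ := by nlinarith [Real.exp_pos (-(Real.pi * |b|))]

/-- Growth of the reciprocal Gamma function on the imaginary axis (with the convention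
`0⁻¹ = 0` at the origin). -/
lemma inv_norm_Gamma_mul_I_sq_le (b : ℝ) :
    (‖Complex.Gamma (b * Complex.I)‖ ^ 2)⁻¹ ≤ |b| * Real.exp (Real.pi * |b|) := by
  rcases eq_or_ne b 0 with rfl | hb
  · simp
  have hz : (b : ℂ) * Complex.I ≠ 0 := by simp [hb]
  have hone : ‖Complex.Gamma (1 - b * Complex.I)‖ = |b| * ‖Complex.Gamma (b * Complex.I)‖ := by
    rw [sub_eq_add_neg, add_comm, Complex.Gamma_add_one _ (neg_ne_zero.2 hz), norm_mul, norm_neg,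
      norm_mul, Complex.norm_I, mul_one, Complex.norm_real, Real.norm_eq_abs,
      ← Complex.norm_conj, ← Complex.Gamma_conj]
    simp
  have hrefl := congrArg norm (Complex.Gamma_mul_Gamma_one_sub (b * Complex.I))
  have harg : (Real.pi : ℂ) * (b * Complex.I) = (Real.pi * b : ℝ) * Complex.I := by
    push_cast; ring
  rw [norm_mul, hone, norm_div, harg, Complex.sin_mul_I, norm_mul, Complex.norm_I, mul_one,
    ← Complex.ofReal_sinh, Complex.norm_real, Complex.norm_real,
    Real.norm_of_nonneg Real.pi_pos.le, Real.norm_eq_abs, Real.abs_sinh, abs_mul,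
    abs_of_pos Real.pi_pos] at hrefl
  have hsinh : 0 < Real.sinh (Real.pi * |b|) := Real.sinh_pos_iff.2 (by positivity)
  have hb' : 0 < |b| := abs_pos.2 hb
  have heq : (‖Complex.Gamma (b * Complex.I)‖ ^ 2)⁻¹ =
      |b| * (Real.sinh (Real.pi * |b|) / Real.pi) := by
    have : ‖Complex.Gamma (b * Complex.I)‖ ^ 2 =
        Real.pi / Real.sinh (Real.pi * |b|) / |b| := by
      rw [← hrefl]; field_simp
    rw [this]; field_simp
  rw [heq]
  gcongr
  rw [div_le_iff₀ Real.pi_pos, Real.sinh_eq]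
  nlinarith [Real.exp_pos (-(Real.pi * |b|)), Real.exp_pos (Real.pi * |b|), Real.pi_gt_three]

lemma measurable_Gamma : Measurable Complex.Gamma := by
  simpa [Pi.inv_def] using Complex.differentiable_one_div_Gamma.continuous.measurable.inv

lemma integrable_exp_neg_mul_abs {δ : ℝ} (hδ : 0 < δ) :
    Integrable fun x : ℝ => Real.exp (-(δ * |x|)) := by
  rw [← integrableOn_univ, ← Set.Iic_union_Ioi (a := (0 : ℝ))]
  refine IntegrableOn.union ?_ ?_
  · refine (integrableOn_exp_mul_Iic hδ 0).congr_fun (fun x hx => ?_) measurableSet_Iic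
    simp [abs_of_nonpos (Set.mem_Iic.1 hx)]
  · refine (integrableOn_exp_mul_Ioi (neg_lt_zero.2 hδ) 0).congr_fun (fun x hx => ?_)
      measurableSet_Ioi
    simp [abs_of_pos (Set.mem_Ioi.1 hx)]

lemma integrable_exp_neg_mul_sum_abs {ι : Type*} [Fintype ι] {δ : ℝ} (hδ : 0 < δ) :
    Integrable fun ξ : ι → ℝ => Real.exp (-(δ * ∑ i, |ξ i|)) := by
  have h := Integrable.fintype_prod (ι := ι) (μ := fun _ => (volume : Measure ℝ))
    (f := fun _ x => Real.exp (-(δ * |x|))) fun _ => integrable_exp_neg_mul_abs hδ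
  simp only [← Real.exp_sum, sum_neg_distrib, ← mul_sum] at h
  exact h

lemma exists_pow_mul_exp_le {ε : ℝ} (hε : 0 < ε) (P : ℕ) :
    ∃ C : ℝ, 0 ≤ C ∧ ∀ S : ℝ, 0 ≤ S → S ^ P ≤ C * Real.exp (ε * S) := by
  refine ⟨P.factorial / ε ^ P, by positivity, fun S hS => ?_⟩
  have h := Real.pow_div_factorial_le_exp (ε * S) (by positivity) P
  rw [div_le_iff₀ (by positivity), mul_pow] at h
  rw [div_mul_eq_mul_div, le_div_iff₀ (by positivity)]
  linarith

/-- The real array underlying `gzOf` when the top row is real. -/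
def realGZ (N : ℕ) (g : ℕ → ℝ) (ξ : GZIdx N → ℝ) : ℕ → ℕ → ℝ := fun n j =>
  if h : 1 ≤ j ∧ j ≤ n ∧ n < N then
    ξ ⟨(⟨n, h.2.2⟩, ⟨j, lt_of_le_of_lt h.2.1 h.2.2⟩), h.1, h.2.1⟩
  else g j

lemma gzOf_eq_ofReal (N : ℕ) (g : ℕ → ℝ) (ξ : GZIdx N → ℝ) (n j : ℕ) :
    gzOf N (fun j => (g j : ℂ)) ξ n j = (realGZ N g ξ n j : ℂ) := by
  unfold gzOf realGZ
  split_ifs <;> rfl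

lemma measurable_realGZ (N : ℕ) (g : ℕ → ℝ) (n j : ℕ) :
    Measurable fun ξ : GZIdx N → ℝ => realGZ N g ξ n j := by
  unfold realGZ
  split_ifs
  · exact measurable_pi_apply _
  · exact measurable_const

lemma abs_realGZ_le_sum (N : ℕ) (g : ℕ → ℝ) (ξ : GZIdx N → ℝ) {n j : ℕ} (hj : j ∈ Icc 1 n)
    (hn : n < N) : |realGZ N g ξ n j| ≤ ∑ p, |ξ p| := by
  rw [mem_Icc] at hj
  rw [realGZ, dif_pos ⟨hj.1, hj.2, hn⟩]
  exact single_le_sum (f := fun p => |ξ p|) (fun _ _ => abs_nonneg _) (mem_univ _)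

/-- The Gelfand–Zetlin integrand of a real array `r` with `K` integrated levels. -/
def gzIntegrand (ℏ : ℝ) (K : ℕ) (r : ℕ → ℕ → ℝ) : ℝ :=
  ∏ n ∈ Icc 1 K,
    (∏ k ∈ Icc 1 n, ∏ m ∈ Icc 1 (n + 1),
      norm (Complex.Gamma (((r n k : ℂ) - r (n + 1) m) / (2 * Complex.I * ℏ) + 1 / 4)) ^ 2) /
    ∏ s ∈ Icc 1 n, ∏ p ∈ Ioc s n,
      norm (Complex.Gamma (((r n s : ℂ) - r n p) / (Complex.I * ℏ))) ^ 2

lemma gzIntegrand_nonneg (ℏ : ℝ) (K : ℕ) (r : ℕ → ℕ → ℝ) : 0 ≤ gzIntegrand ℏ K r := by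
  unfold gzIntegrand
  positivity

lemma measurable_gzIntegrand {Ω : Type*} [MeasurableSpace Ω] (ℏ : ℝ) (K : ℕ)
    {r : Ω → ℕ → ℕ → ℝ} (hr : ∀ n j, Measurable fun ω => r ω n j) :
    Measurable fun ω => gzIntegrand ℏ K (r ω) := by
  have hr' : ∀ n j, Measurable fun ω => (r ω n j : ℂ) := fun n j =>
    Complex.measurable_ofReal.comp (hr n j)
  unfold gzIntegrand
  refine Finset.measurable_fun_prod _ fun n _ => Measurable.div ?_ ?_
  · refine Finset.measurable_fun_prod _ fun k _ => Finset.measurable_fun_prod _ fun m _ => ?_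
    exact ((measurable_Gamma.comp
      ((((hr' n k).sub (hr' (n + 1) m)).div_const _).add_const _)).norm).pow_const 2
  · refine Finset.measurable_fun_prod _ fun s _ => Finset.measurable_fun_prod _ fun p _ => ?_
    exact ((measurable_Gamma.comp (((hr' n s).sub (hr' n p)).div_const _)).norm).pow_const 2

lemma sub_div_two_mul_I_mul (a b ℏ : ℝ) :
    ((a : ℂ) - b) / (2 * Complex.I * ℏ) = (((b - a) / (2 * ℏ) : ℝ) : ℂ) * Complex.I := by
  rw [mul_right_comm, ← div_div, Complex.div_I]
  push_cast
  ring

lemma sub_div_I_mul (a b ℏ : ℝ) :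
    ((a : ℂ) - b) / (Complex.I * ℏ) = (((b - a) / ℏ : ℝ) : ℂ) * Complex.I := by
  rw [mul_comm Complex.I, ← div_div, Complex.div_I]
  push_cast
  ring

/-- The integrand is bounded by a power of the size of the array times the exponential of minus
the energy. -/
lemma exists_gzIntegrand_le {ℏ : ℝ} (hℏ : 0 < ℏ) (K : ℕ) :
    ∃ (C : ℝ) (P : ℕ), 0 ≤ C ∧ ∀ (r : ℕ → ℕ → ℝ) (S : ℝ), 0 ≤ S →
      (∀ n ∈ Icc 1 K, ∀ k ∈ Icc 1 n, |r n k| ≤ S) →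
      gzIntegrand ℏ K r ≤ C * S ^ P * Real.exp (-(Real.pi / (2 * ℏ) * ∑ i ∈ Icc 1 K,
        (∑ k ∈ Icc 1 i, ∑ m ∈ Icc 1 (i + 1), |r i k - r (i + 1) m| -
          2 * ∑ s ∈ Icc 1 i, ∑ p ∈ Ioc s i, |r i s - r i p|))) := by
  obtain ⟨c, hc, hΓ⟩ := exists_norm_Gamma_quarter_sq_le
  set α := Real.pi / (2 * ℏ) with hα
  have hπ := Real.pi_pos
  have hnum : ∀ a b : ℝ, ‖Complex.Gamma (((a : ℂ) - b) / (2 * Complex.I * ℏ) + 1 / 4)‖ ^ 2 ≤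
      c * Real.exp (-(α * |a - b|)) := fun a b => by
    rw [sub_div_two_mul_I_mul, add_comm]
    refine (hΓ _).trans_eq ?_
    rw [abs_div, abs_sub_comm, abs_of_pos (by positivity : 0 < 2 * ℏ), hα]
    ring_nf
  have hden : ∀ a b S : ℝ, |a| ≤ S → |b| ≤ S →
      (‖Complex.Gamma (((a : ℂ) - b) / (Complex.I * ℏ))‖ ^ 2)⁻¹ ≤
        (2 / ℏ * S) * Real.exp (2 * α * |a - b|) := fun a b S ha hb => by
    rw [sub_div_I_mul]
    refine (inv_norm_Gamma_mul_I_sq_le _).trans ?_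
    have h1 : |(b - a) / ℏ| = |a - b| / ℏ := by rw [abs_div, abs_sub_comm, abs_of_pos hℏ]
    have h2 : Real.pi * (|a - b| / ℏ) = 2 * α * |a - b| := by rw [hα]; field_simp
    have h3 : |a - b| ≤ 2 * S := (abs_sub a b).trans (by linarith)
    rw [h1, h2]
    refine mul_le_mul_of_nonneg_right ?_ (Real.exp_pos _).le
    calc |a - b| / ℏ ≤ 2 * S / ℏ := by gcongr
      _ = 2 / ℏ * S := by ring
  refine ⟨∏ n ∈ Icc 1 K, ((∏ k ∈ Icc 1 n, ∏ m ∈ Icc 1 (n + 1), c) *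
    ∏ s ∈ Icc 1 n, ∏ p ∈ Ioc s n, 2 / ℏ), ∑ n ∈ Icc 1 K, ∑ s ∈ Icc 1 n, #(Ioc s n),
    by positivity, fun r S hS hr => ?_⟩
  rw [gzIntegrand, mul_sum, ← sum_neg_distrib, Real.exp_sum, ← prod_pow_eq_pow_sum,
    ← prod_mul_distrib, ← prod_mul_distrib]
  refine prod_le_prod (fun n _ => by positivity) fun n hn => ?_
  have h1 : (∏ k ∈ Icc 1 n, ∏ m ∈ Icc 1 (n + 1),
      ‖Complex.Gamma (((r n k : ℂ) - r (n + 1) m) / (2 * Complex.I * ℏ) + 1 / 4)‖ ^ 2) ≤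
      (∏ k ∈ Icc 1 n, ∏ m ∈ Icc 1 (n + 1), c) *
        Real.exp (-(α * ∑ k ∈ Icc 1 n, ∑ m ∈ Icc 1 (n + 1), |r n k - r (n + 1) m|)) := by
    simp only [mul_sum, ← sum_neg_distrib, Real.exp_sum, ← prod_mul_distrib]
    exact prod_le_prod (fun k _ => by positivity) fun k _ =>
      prod_le_prod (fun m _ => by positivity) fun m _ => hnum _ _
  have h2 : (∏ s ∈ Icc 1 n, ∏ p ∈ Ioc s n,
      ‖Complex.Gamma (((r n s : ℂ) - r n p) / (Complex.I * ℏ))‖ ^ 2)⁻¹ ≤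
      (∏ s ∈ Icc 1 n, ∏ p ∈ Ioc s n, 2 / ℏ) * S ^ (∑ s ∈ Icc 1 n, #(Ioc s n)) *
        Real.exp (2 * α * ∑ s ∈ Icc 1 n, ∑ p ∈ Ioc s n, |r n s - r n p|) := by
    simp only [mul_sum, Real.exp_sum, ← prod_pow_eq_pow_sum, ← prod_const S,
      ← prod_mul_distrib, ← prod_inv_distrib]
    refine prod_le_prod (fun s _ => by positivity) fun s hs =>
      prod_le_prod (fun p _ => by positivity) fun p hp => hden _ _ _ (hr n hn s hs) (hr n hn p ?_)
    simp only [mem_Icc, mem_Ioc] at hs hp ⊢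
    omega
  rw [div_eq_mul_inv]
  refine (mul_le_mul h1 h2 (by positivity) (by positivity)).trans_eq ?_
  rw [mul_sub, neg_sub, sub_eq_add_neg, Real.exp_add]
  ring_nf

lemma integrable_gzIntegrand {ℏ : ℝ} (hℏ : 0 < ℏ) (K : ℕ) (hK : 1 ≤ K) (g : ℕ → ℝ) :
    Integrable fun ξ : GZIdx (K + 1) → ℝ => gzIntegrand ℏ K (realGZ (K + 1) g ξ) := by
  obtain ⟨C, P, hC, hle⟩ := exists_gzIntegrand_le hℏ K
  set α := Real.pi / (2 * ℏ) with hα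
  have hα0 : 0 < α := by positivity
  have : Nonempty (GZIdx (K + 1)) := ⟨⟨(⟨1, by omega⟩, ⟨1, by omega⟩), le_rfl, le_rfl⟩⟩
  set c : ℝ := (Fintype.card (GZIdx (K + 1)) : ℝ) with hc
  have hc0 : 0 < c := by rw [hc]; exact_mod_cast Fintype.card_pos
  set M : ℝ := ∑ m ∈ Icc 1 (K + 1), |g m| with hM
  obtain ⟨A, hA, hpow⟩ := exists_pow_mul_exp_le (by positivity : 0 < α / c) P
  refine ((integrable_exp_neg_mul_sum_abs (ι := GZIdx (K + 1))
    (by positivity : 0 < α / c)).const_mul (C * A * Real.exp (2 * α * M))).mono'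
    (measurable_gzIntegrand ℏ K (measurable_realGZ (K + 1) g)).aestronglyMeasurable
    (Filter.Eventually.of_forall fun ξ => ?_)
  rw [Real.norm_of_nonneg (gzIntegrand_nonneg _ _ _)]
  set S := ∑ p, |ξ p| with hS
  have hS0 : 0 ≤ S := sum_nonneg fun _ _ => abs_nonneg _
  refine (hle (realGZ (K + 1) g ξ) S hS0 fun n hn k hk => abs_realGZ_le_sum _ _ _ hk
    (Nat.lt_succ_of_le (mem_Icc.1 hn).2)).trans ?_
  set E := ∑ i ∈ Icc 1 K, (∑ k ∈ Icc 1 i, ∑ m ∈ Icc 1 (i + 1),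
    |realGZ (K + 1) g ξ i k - realGZ (K + 1) g ξ (i + 1) m| -
      2 * ∑ s ∈ Icc 1 i, ∑ p ∈ Ioc s i, |realGZ (K + 1) g ξ i s - realGZ (K + 1) g ξ i p|) with hE
  have htop : ∀ m ∈ Icc 1 (K + 1), |realGZ (K + 1) g ξ (K + 1) m| ≤ M := fun m hm => by
    rw [realGZ, dif_neg (by omega)]
    exact single_le_sum (f := fun m => |g m|) (fun _ _ => abs_nonneg _) hm
  have hcoord : ∀ p : GZIdx (K + 1), 2 * (|ξ p| - M) ≤ E := by
    rintro ⟨⟨⟨n, hn⟩, ⟨k, hk⟩⟩, h1, h2⟩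
    have h := abs_le_gzEnergy (realGZ (K + 1) g ξ) K htop (mem_Icc.2 ⟨h1, h2⟩)
      (Nat.le_of_lt_succ hn)
    rwa [realGZ, dif_pos ⟨h1, h2, hn⟩] at h
  have hsum : 2 * (S - c * M) ≤ c * E := by
    have h := sum_le_sum fun p (_ : p ∈ univ) => hcoord p
    simpa [← mul_sum, sum_sub_distrib, ← hS, ← hc] using h
  have hEle : -(α * E) ≤ 2 * α * M - α / c * S - α / c * S := by
    have h := mul_le_mul_of_nonneg_left hsum (by positivity : 0 ≤ α / c)
    have h1 : α / c * (c * E) = α * E := by field_simp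
    have h2 : α / c * (2 * (S - c * M)) = α / c * S + α / c * S - 2 * α * M := by
      field_simp; ring
    linarith
  calc C * S ^ P * Real.exp (-(α * E))
      ≤ C * (A * Real.exp (α / c * S)) * Real.exp (2 * α * M - α / c * S - α / c * S) := by
        gcongr
        exact hpow S hS0
    _ = C * A * Real.exp (2 * α * M) * Real.exp (-(α / c * S)) *
          (Real.exp (α / c * S) * Real.exp (-(α / c * S))) := by
        rw [sub_eq_add_neg, sub_eq_add_neg, Real.exp_add, Real.exp_add]; ring
    _ = _ := by rw [← Real.exp_add, add_neg_cancel, Real.exp_zero, mul_one]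

/-- absolute convergence of the integral representation of the
hyperbolic Sutherland eigenfunction: the product of the `|Γ|²` factors is
Lebesgue integrable over `ℝ^{N(N−1)/2}`. -/
theorem sutherland_integrand_integrable (ℏ : ℝ) (hℏ : 0 < ℏ) (N : ℕ) (hN : 2 ≤ N)
    (γtop : ℕ → ℝ) :
    Integrable (fun ξ : GZIdx N → ℝ =>
      ∏ n ∈ Icc 1 (N - 1),
        (∏ k ∈ Icc 1 n, ∏ m ∈ Icc 1 (n + 1),
          norm (Complex.Gamma
            ((gzOf N (fun j => (γtop j : ℂ)) ξ n k - gzOf N (fun j => (γtop j : ℂ)) ξ (n + 1) m) /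
              (2 * Complex.I * ℏ) + 1 / 4)) ^ 2) /
        ∏ s ∈ Icc 1 n, ∏ p ∈ Ioc s n,
          norm (Complex.Gamma
            ((gzOf N (fun j => (γtop j : ℂ)) ξ n s - gzOf N (fun j => (γtop j : ℂ)) ξ n p) /
              (Complex.I * ℏ))) ^ 2) := by
  obtain ⟨K, rfl⟩ : ∃ K, N = K + 1 := ⟨N - 1, by omega⟩
  simpa only [gzOf_eq_ofReal, gzIntegrand, Nat.add_sub_cancel] using
    integrable_gzIntegrand hℏ K (by omega) γtop
end
end
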